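/- arXiv:1211.7325 — 4 statements merged into one kernel-verified Lean document; each statement's English description precedes it below -/
import Mathlib

section
/- For all real ν ≥ 1/2 and all x > 0, ∫_x^∞ t^ν K_ν(t) dt ≤ (√π Γ(ν+1/2)/Γ(ν)) x^ν K_ν(x). -/
open Real MeasureTheory

/-- The modified Bessel function of the second kind
`K_ν(x) = ∫_0^∞ e^{-x cosh t} cosh(ν t) dt`. -/
noncomputable def besselK (ν x : ℝ) : ℝ :=
  ∫ t in Set.Ioi (0 : ℝ), Real.exp (-x * Real.cosh t) * Real.cosh (ν * t)

open Set Filter Topology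

/-- The integrand of `besselP`. -/
noncomputable def besselKernel (a c t : ℝ) : ℝ :=
  exp (a * t - exp t - c * exp (-t))

/-- The function `∫ u in (0, ∞), u ^ (a - 1) * exp (-u - x ^ 2 / (4 * u))`, written in the
variable `t = log u`. It equals `2 ^ (1 - a) * x ^ a * K_a(x)` for `x > 0`. -/
noncomputable def besselP (a x : ℝ) : ℝ :=
  ∫ t, besselKernel a (x ^ 2 / 4) t

lemma besselKernel_pos (a c t : ℝ) : 0 < besselKernel a c t := exp_pos _

lemma continuous_besselKernel (a c : ℝ) : Continuous (besselKernel a c) := by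
  unfold besselKernel; fun_prop

lemma besselKernel_anti (a t : ℝ) {c d : ℝ} (h : c ≤ d) :
    besselKernel a d t ≤ besselKernel a c t := by
  unfold besselKernel
  gcongr

lemma hasDerivWithinAt_exp_univ (t : ℝ) (_ : t ∈ univ) :
    HasDerivWithinAt exp (exp t) univ t :=
  (Real.hasDerivAt_exp t).hasDerivWithinAt

lemma abs_exp_smul_gamma_integrand (a t : ℝ) :
    |exp t| • (exp (-exp t) * exp t ^ (a - 1)) = besselKernel a 0 t := by
  rw [abs_of_pos (exp_pos t), smul_eq_mul, ← Real.exp_mul, ← Real.exp_add, ← Real.exp_add,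
    besselKernel]
  congr 1
  ring

lemma integrable_besselKernel_zero {a : ℝ} (ha : 0 < a) : Integrable (besselKernel a 0) := by
  have h := Real.GammaIntegral_convergent ha
  rw [← Real.range_exp, ← image_univ, integrableOn_image_iff_integrableOn_abs_deriv_smul
    MeasurableSet.univ hasDerivWithinAt_exp_univ Real.exp_injective.injOn, integrableOn_univ] at h
  simpa only [abs_exp_smul_gamma_integrand] using h

lemma integral_besselKernel_zero {a : ℝ} (ha : 0 < a) : ∫ t, besselKernel a 0 t = Gamma a := by
  rw [Real.Gamma_eq_integral ha, ← Real.range_exp, ← image_univ,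
    integral_image_eq_integral_abs_deriv_smul
    MeasurableSet.univ hasDerivWithinAt_exp_univ Real.exp_injective.injOn, setIntegral_univ]
  simp only [abs_exp_smul_gamma_integrand]

lemma besselKernel_le (a : ℝ) {c : ℝ} (hc : 0 < c) (n : ℕ) (t : ℝ) :
    besselKernel a c t ≤ (n.factorial / c ^ n) * besselKernel (a + n) 0 t := by
  have hy : 0 < c * exp (-t) := by positivity
  have h1 : (c * exp (-t)) ^ n / n.factorial ≤ exp (c * exp (-t)) :=
    Real.pow_div_factorial_le_exp _ hy.le n
  have hn : (0 : ℝ) < n.factorial := by exact_mod_cast n.factorial_pos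
  have h2 : exp (-(c * exp (-t))) ≤ (n.factorial / c ^ n) * exp (n * t) := by
    rw [Real.exp_neg]
    calc (exp (c * exp (-t)))⁻¹ ≤ ((c * exp (-t)) ^ n / n.factorial)⁻¹ :=
          inv_anti₀ (by positivity) h1
      _ = (n.factorial / c ^ n) * exp (n * t) := by
          rw [mul_pow, ← Real.exp_nat_mul, mul_neg, Real.exp_neg]
          field_simp
  calc besselKernel a c t = exp (a * t - exp t) * exp (-(c * exp (-t))) := by
        rw [besselKernel, ← Real.exp_add]; congr 1
    _ ≤ exp (a * t - exp t) * ((n.factorial / c ^ n) * exp (n * t)) := by gcongr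
    _ = (n.factorial / c ^ n) * besselKernel (a + n) 0 t := by
        rw [mul_left_comm, ← Real.exp_add, besselKernel]
        congr 2
        ring

lemma integrable_besselKernel (a : ℝ) {c : ℝ} (hc : 0 < c) : Integrable (besselKernel a c) := by
  obtain ⟨n, hn⟩ := exists_nat_gt (-a)
  refine ((integrable_besselKernel_zero (a := a + n) (by linarith)).const_mul
    (n.factorial / c ^ n)).mono' (continuous_besselKernel a c).aestronglyMeasurable
    (ae_of_all _ fun t => ?_)
  rw [Real.norm_of_nonneg (besselKernel_pos _ _ _).le]
  exact besselKernel_le a hc n t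

lemma besselP_pos (a : ℝ) {x : ℝ} (hx : 0 < x) : 0 < besselP a x := by
  refine (integral_pos_iff_support_of_nonneg (fun t => (besselKernel_pos _ _ t).le)
    (integrable_besselKernel a (by positivity))).2 ?_
  have : Function.support (besselKernel a (x ^ 2 / 4)) = univ :=
    eq_univ_of_forall fun t => (besselKernel_pos _ _ t).ne'
  simp [this]

lemma besselP_zero {a : ℝ} (ha : 0 < a) : besselP a 0 = Gamma a := by
  simp [besselP, integral_besselKernel_zero ha]

lemma continuous_besselP {a : ℝ} (ha : 0 < a) : Continuous (besselP a) := by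
  refine continuous_of_dominated (bound := besselKernel a 0)
    (fun x => (continuous_besselKernel a _).aestronglyMeasurable)
    (fun x => ae_of_all _ fun t => ?_) (integrable_besselKernel_zero ha)
    (ae_of_all _ fun t => ?_)
  · rw [Real.norm_of_nonneg (besselKernel_pos _ _ _).le]
    exact besselKernel_anti a t (by positivity)
  · unfold besselKernel; fun_prop

lemma hasDerivAt_besselP (a : ℝ) {x : ℝ} (hx : 0 < x) :
    HasDerivAt (besselP a) (-(x / 2) * besselP (a - 1) x) x := by
  have key := (hasDerivAt_integral_of_dominated_loc_of_deriv_le (μ := volume) (x₀ := x)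
    (s := Ioo (x / 2) (2 * x)) (F := fun y t => besselKernel a (y ^ 2 / 4) t)
    (F' := fun y t => -(y / 2) * besselKernel (a - 1) (y ^ 2 / 4) t)
    (bound := fun t => x * besselKernel (a - 1) (x ^ 2 / 16) t)
    (Ioo_mem_nhds (by linarith) (by linarith))
    (Eventually.of_forall fun y => (continuous_besselKernel a _).aestronglyMeasurable)
    (integrable_besselKernel a (by positivity))
    ((continuous_besselKernel (a - 1) _).const_mul _).aestronglyMeasurable
    (ae_of_all _ fun t y hy => ?_)
    ((integrable_besselKernel (a - 1) (by positivity)).const_mul _)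
    (ae_of_all _ fun t y hy => ?_)).2
  · rw [integral_const_mul] at key
    exact key
  · obtain ⟨h1, h2⟩ := hy
    rw [norm_mul, Real.norm_of_nonneg (besselKernel_pos _ _ _).le, norm_neg,
      Real.norm_of_nonneg (by linarith)]
    refine mul_le_mul (by linarith) (besselKernel_anti _ _ (by nlinarith))
      (besselKernel_pos _ _ _).le hx.le
  · have h : HasDerivAt (fun y : ℝ => a * t - exp t - y ^ 2 / 4 * exp (-t))
        (-(y / 2) * exp (-t)) y := by
      have := (((hasDerivAt_pow 2 y).div_const 4).mul_const (exp (-t))).const_sub (a * t - exp t)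
      convert! this using 1
      norm_num
      ring
    convert! h.exp using 1
    rw [besselKernel, mul_left_comm, ← Real.exp_add]
    congr 2
    ring

/-- The three-term recurrence, from integrating `(besselKernel a c)'` over the line. -/
lemma besselP_recurrence (a : ℝ) {x : ℝ} (hx : 0 < x) :
    besselP (a + 1) x = a * besselP a x + x ^ 2 / 4 * besselP (a - 1) x := by
  have hc : 0 < x ^ 2 / 4 := by positivity
  have hder (t : ℝ) : HasDerivAt (besselKernel a (x ^ 2 / 4))
      (a * besselKernel a (x ^ 2 / 4) t - besselKernel (a + 1) (x ^ 2 / 4) t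
        + x ^ 2 / 4 * besselKernel (a - 1) (x ^ 2 / 4) t) t := by
    have h : HasDerivAt (fun t : ℝ => a * t - exp t - x ^ 2 / 4 * exp (-t))
        (a * 1 - exp t - x ^ 2 / 4 * (exp (-t) * -1)) t :=
      (((hasDerivAt_id t).const_mul a).sub (Real.hasDerivAt_exp t)).sub
        ((hasDerivAt_neg t).exp.const_mul _)
    convert! h.exp using 1
    have e1 : besselKernel (a + 1) (x ^ 2 / 4) t = besselKernel a (x ^ 2 / 4) t * exp t := by
      simp only [besselKernel, ← Real.exp_add]; congr 1; ring
    have e2 : besselKernel (a - 1) (x ^ 2 / 4) t = besselKernel a (x ^ 2 / 4) t * exp (-t) := by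
      simp only [besselKernel, ← Real.exp_add]; congr 1; ring
    rw [e1, e2, besselKernel]
    ring
  have i0 := integrable_besselKernel a hc
  have i1 := integrable_besselKernel (a + 1) hc
  have i2 := integrable_besselKernel (a - 1) hc
  have h := integral_eq_zero_of_hasDerivAt_of_integrable hder
    (((i0.const_mul a).sub i1).add (i2.const_mul _)) i0
  have hsub : Integrable fun t =>
      a * besselKernel a (x ^ 2 / 4) t - besselKernel (a + 1) (x ^ 2 / 4) t :=
    (i0.const_mul a).sub i1
  rw [integral_add hsub (i2.const_mul _), integral_sub (i0.const_mul a) i1,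
    integral_const_mul, integral_const_mul] at h
  unfold besselP
  linarith

lemma besselP_le {a x : ℝ} (ha : 0 < a) (hx : 0 < x) :
    besselP a x ≤ Gamma (a + 1) * (4 / x ^ 2) := by
  have h : besselP a x ≤ ∫ t, (4 / x ^ 2) * besselKernel (a + 1) 0 t := by
    refine integral_mono (integrable_besselKernel a (by positivity))
      ((integrable_besselKernel_zero (by linarith)).const_mul _) fun t => ?_
    have := besselKernel_le a (c := x ^ 2 / 4) (by positivity) 1 t
    simpa using this
  rw [integral_const_mul, integral_besselKernel_zero (by linarith)] at h
  linarith

/-- The numerator of the derivative of `x * besselP (ν - 1) x / (2 * besselP ν x)`. -/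
noncomputable def besselWronskian (ν x : ℝ) : ℝ :=
  x ^ 2 / 4 * besselP (ν - 1) x ^ 2 + (ν - 1 / 2) * besselP (ν - 1) x * besselP ν x
    - besselP ν x ^ 2

lemma hasDerivAt_rpow_mul_besselWronskian (ν : ℝ) {x : ℝ} (hx : 0 < x) :
    HasDerivAt (fun y => y ^ (1 - 2 * ν) * besselWronskian ν y)
      (-(x ^ (1 - 2 * ν) * ((ν - 1 / 2) / x * besselP (ν - 1) x * besselP ν x))) x := by
  have hB := hasDerivAt_besselP ν hx
  have hA : HasDerivAt (besselP (ν - 1))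
      (-(2 / x) * (besselP ν x - (ν - 1) * besselP (ν - 1) x)) x := by
    convert! hasDerivAt_besselP (ν - 1) hx using 1
    have := besselP_recurrence (ν - 1) hx
    rw [sub_add_cancel] at this
    rw [this]
    field_simp
    ring
  have hN := (((((hasDerivAt_pow 2 x).div_const 4).mul (hA.pow 2)).add
    ((hA.const_mul (ν - 1 / 2)).mul hB)).sub (hB.pow 2))
  have hp := Real.hasDerivAt_rpow_const (p := 1 - 2 * ν) (Or.inl hx.ne')
  convert! hp.mul hN using 1
  rw [Real.rpow_sub_one hx.ne']
  simp
  field_simp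
  ring

lemma besselWronskian_nonneg {ν x : ℝ} (hν : 1 / 2 ≤ ν) (hx : 0 < x) :
    0 ≤ besselWronskian ν x := by
  have hanti : AntitoneOn (fun y => y ^ (1 - 2 * ν) * besselWronskian ν y) (Ioi 0) := by
    refine antitoneOn_of_deriv_nonpos (convex_Ioi 0)
      (fun y hy => (hasDerivAt_rpow_mul_besselWronskian ν hy).continuousAt.continuousWithinAt)
      ?_ ?_
    · rw [interior_Ioi]
      exact fun y hy =>
        (hasDerivAt_rpow_mul_besselWronskian ν hy).differentiableAt.differentiableWithinAt
    · rw [interior_Ioi]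
      intro y hy
      have hy' : 0 < y := hy
      rw [(hasDerivAt_rpow_mul_besselWronskian ν hy).deriv, neg_nonpos]
      have h1 := besselP_pos ν hy'
      have h2 := besselP_pos (ν - 1) hy'
      have h3 : 0 ≤ ν - 1 / 2 := by linarith
      positivity
  have hlim : Tendsto (fun y : ℝ => -(Gamma (ν + 1) * (4 / y ^ 2)) ^ 2) atTop (𝓝 0) := by
    have h : Tendsto (fun y : ℝ => 4 / y ^ 2) atTop (𝓝 0) :=
      tendsto_const_nhds.div_atTop (tendsto_pow_atTop two_ne_zero)
    simpa using ((h.const_mul (Gamma (ν + 1))).pow 2).neg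
  have hM : 0 ≤ x ^ (1 - 2 * ν) * besselWronskian ν x := by
    refine le_of_tendsto hlim ?_
    filter_upwards [eventually_ge_atTop x, eventually_ge_atTop 1] with y hxy h1y
    have hy : 0 < y := by linarith
    refine le_trans ?_ (hanti hx hy hxy)
    have hB := besselP_pos ν hy
    have hA := besselP_pos (ν - 1) hy
    have h3 : 0 ≤ ν - 1 / 2 := by linarith
    have hW : -besselP ν y ^ 2 ≤ besselWronskian ν y := by
      have : 0 ≤ y ^ 2 / 4 * besselP (ν - 1) y ^ 2
        + (ν - 1 / 2) * besselP (ν - 1) y * besselP ν y := by positivity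
      unfold besselWronskian
      linarith
    have hpow : y ^ (1 - 2 * ν) ≤ 1 := Real.rpow_le_one_of_one_le_of_nonpos h1y (by linarith)
    have hpow0 : 0 ≤ y ^ (1 - 2 * ν) := by positivity
    have hle : besselP ν y ^ 2 ≤ (Gamma (ν + 1) * (4 / y ^ 2)) ^ 2 := by
      gcongr
      exact besselP_le (by linarith) hy
    nlinarith [mul_le_mul_of_nonneg_left hW hpow0,
      mul_le_mul_of_nonneg_right hpow (sq_nonneg (besselP ν y))]
  exact nonneg_of_mul_nonneg_right hM (by positivity)

lemma monotoneOn_besselP_ratio {ν : ℝ} (hν : 1 / 2 ≤ ν) :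
    MonotoneOn (fun x => x / 2 * besselP (ν - 1) x / besselP ν x) (Ioi 0) := by
  have hder {x : ℝ} (hx : 0 < x) :
      HasDerivAt (fun x => x / 2 * besselP (ν - 1) x / besselP ν x)
        (besselWronskian ν x / besselP ν x ^ 2) x := by
    have hB := besselP_pos ν hx
    have h := (((hasDerivAt_id x).div_const 2).mul (hasDerivAt_besselP (ν - 1) hx)).div
      (hasDerivAt_besselP ν hx) hB.ne'
    convert! h using 1
    have hrec := besselP_recurrence (ν - 1) hx
    rw [sub_add_cancel] at hrec
    congr 1
    simp only [id, Pi.mul_apply]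
    rw [besselWronskian]
    linear_combination (-besselP ν x) * hrec
  refine monotoneOn_of_deriv_nonneg (convex_Ioi 0)
    (fun y hy => (hder hy).continuousAt.continuousWithinAt) ?_ ?_
  · rw [interior_Ioi]
    exact fun y hy => (hder hy).differentiableAt.differentiableWithinAt
  · rw [interior_Ioi]
    intro y hy
    rw [(hder hy).deriv]
    exact div_nonneg (besselWronskian_nonneg hν hy) (sq_nonneg _)

/-- Submultiplicativity, a consequence of log-concavity of `besselP ν`. -/
lemma besselP_add_le {ν x s : ℝ} (hν : 1 / 2 ≤ ν) (hx : 0 < x) (hs : 0 < s) :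
    besselP ν (x + s) ≤ besselP ν x / Gamma ν * besselP ν s := by
  have hν0 : 0 < ν := by linarith
  have hpos {y : ℝ} (hy : 0 ≤ y) : 0 < besselP ν y := by
    rcases hy.eq_or_lt with rfl | hy
    · rw [besselP_zero hν0]
      exact Gamma_pos_of_pos hν0
    · exact besselP_pos ν hy
  have hder {y : ℝ} (hy : 0 < y) := ((hasDerivAt_besselP ν (add_pos hy hs)).comp_add_const y s).div
      (hasDerivAt_besselP ν hy) (hpos hy.le).ne'
  have hanti : AntitoneOn (fun y => besselP ν (y + s) / besselP ν y) (Ici 0) := by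
    refine antitoneOn_of_deriv_nonpos (convex_Ici 0) ?_ ?_ ?_
    · exact (((continuous_besselP hν0).comp (continuous_add_const s)).continuousOn).div
        (continuous_besselP hν0).continuousOn fun y hy => (hpos hy).ne'
    · rw [interior_Ici]
      exact fun y hy => (hder hy).differentiableAt.differentiableWithinAt
    · rw [interior_Ici]
      intro y hy
      have hy' : 0 < y := hy
      refine (hder hy).deriv.trans_le ?_
      have hmono := monotoneOn_besselP_ratio hν hy (add_pos hy' hs : y + s ∈ Ioi 0)
        (by linarith)
      simp only at hmono
      rw [div_le_div_iff₀ (hpos hy'.le) (hpos (add_pos hy' hs).le)] at hmono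
      refine div_nonpos_of_nonpos_of_nonneg ?_ (sq_nonneg _)
      linarith
  have h := hanti (mem_Ici.2 le_rfl) hx.le hx.le
  simp only [zero_add] at h
  rw [besselP_zero hν0, div_le_iff₀ (hpos hx.le)] at h
  calc _ ≤ _ := h
    _ = _ := by ring

lemma integral_Ioi_besselKernel (a t : ℝ) :
    ∫ x in Ioi (0 : ℝ), besselKernel a (x ^ 2 / 4) t = √π * besselKernel (a + 1 / 2) 0 t := by
  have h (x : ℝ) : besselKernel a (x ^ 2 / 4) t
      = exp (a * t - exp t) * exp (-(exp (-t) / 4) * x ^ 2) := by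
    rw [← Real.exp_add, besselKernel]; congr 1; ring
  simp only [h]
  rw [integral_const_mul, integral_gaussian_Ioi]
  have h2 : π / (exp (-t) / 4) = π * (2 * exp (t / 2)) ^ 2 := by
    rw [mul_pow, ← Real.exp_nat_mul, Real.exp_neg]
    field_simp
    ring_nf
  rw [h2, Real.sqrt_mul pi_pos.le, Real.sqrt_sq (by positivity)]
  have h3 : besselKernel (a + 1 / 2) 0 t = exp (a * t - exp t) * exp (t / 2) := by
    rw [← Real.exp_add, besselKernel]; congr 1; ring
  rw [h3]
  ring

lemma integrable_besselKernel_prod {a : ℝ} (ha : 0 < a) :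
    Integrable (Function.uncurry fun x t : ℝ => besselKernel a (x ^ 2 / 4) t)
      ((volume.restrict (Ioi 0)).prod volume) := by
  have hc : Continuous (Function.uncurry fun x t : ℝ => besselKernel a (x ^ 2 / 4) t) := by
    unfold besselKernel Function.uncurry; fun_prop
  rw [integrable_prod_iff' hc.aestronglyMeasurable]
  refine ⟨ae_of_all _ fun t => ?_, ?_⟩
  · have h := (integrable_exp_neg_mul_sq (b := exp (-t) / 4) (by positivity)).const_mul
      (exp (a * t - exp t))
    refine h.integrableOn.congr (ae_of_all _ fun x => ?_)
    simp only [Function.uncurry, besselKernel]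
    rw [← Real.exp_add]; congr 1; ring
  · simp only [Function.uncurry, Real.norm_of_nonneg (besselKernel_pos _ _ _).le,
      integral_Ioi_besselKernel]
    exact (integrable_besselKernel_zero (by linarith)).const_mul _

lemma integrableOn_besselP {a : ℝ} (ha : 0 < a) : IntegrableOn (besselP a) (Ioi 0) :=
  (integrable_besselKernel_prod ha).integral_prod_left

lemma integral_besselP {a : ℝ} (ha : 0 < a) :
    ∫ x in Ioi (0 : ℝ), besselP a x = √π * Gamma (a + 1 / 2) := by
  simp only [besselP]
  rw [integral_integral_swap (integrable_besselKernel_prod ha)]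
  simp only [integral_Ioi_besselKernel]
  rw [integral_const_mul, integral_besselKernel_zero (by linarith)]

lemma rpow_mul_besselK (ν : ℝ) {x : ℝ} (hx : 0 < x) :
    x ^ ν * besselK ν x = 2 ^ ν / 2 * besselP ν x := by
  let F : ℝ → ℝ := fun t => exp (ν * t - x * cosh t)
  have hshift (t : ℝ) : besselKernel ν (x ^ 2 / 4) (t + log (x / 2)) = (x / 2) ^ ν * F t := by
    have hx2 : 0 < x / 2 := by positivity
    simp only [F]
    rw [Real.rpow_def_of_pos hx2, ← Real.exp_add, besselKernel, neg_add, Real.exp_add,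
      Real.exp_add (-t), Real.exp_neg (log (x / 2)), Real.exp_log hx2, Real.cosh_eq]
    congr 1
    field_simp
    ring
  have hpow : (x / 2) ^ ν ≠ 0 := (Real.rpow_pos_of_pos (by positivity) ν).ne'
  have hF : Integrable F := by
    have h := (integrable_besselKernel ν (c := x ^ 2 / 4) (by positivity)).comp_add_right
      (log (x / 2))
    simp only [hshift] at h
    exact (integrable_const_mul_iff (Ne.isUnit hpow) _).1 h
  have hP : besselP ν x = (x / 2) ^ ν * ∫ t, F t := by
    rw [besselP, ← integral_add_right_eq_self _ (log (x / 2))]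
    simp only [hshift, integral_const_mul]
  have hK : ∫ t, F t = 2 * besselK ν x := by
    have hneg := integral_comp_neg_Ioi (0 : ℝ) F
    rw [neg_zero] at hneg
    rw [← intervalIntegral.integral_Iic_add_Ioi (b := 0) hF.integrableOn hF.integrableOn, ← hneg,
      ← integral_add hF.comp_neg.integrableOn hF.integrableOn, besselK, ← integral_const_mul]
    congr 1
    ext t
    simp only [F, Real.cosh_neg]
    rw [Real.cosh_eq (ν * t), sub_eq_add_neg, sub_eq_add_neg, Real.exp_add, Real.exp_add]
    ring_nf
  rw [hP, hK, Real.div_rpow hx.le two_pos.le]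
  have h2 : (2 : ℝ) ^ ν ≠ 0 := (Real.rpow_pos_of_pos two_pos ν).ne'
  field_simp

theorem integral_besselK_le (ν : ℝ) (hν : 1 / 2 ≤ ν) (x : ℝ) (hx : 0 < x) :
    (∫ t in Set.Ioi x, t ^ ν * besselK ν t) ≤
      (Real.sqrt π * Real.Gamma (ν + 1 / 2) / Real.Gamma ν) * x ^ ν * besselK ν x := by
  have hν0 : 0 < ν := by linarith
  have hint : IntegrableOn (besselP ν) (Ioi x) :=
    (integrableOn_besselP hν0).mono_set (Ioi_subset_Ioi hx.le)
  have himage : (fun s => x + s) '' Ioi 0 = Ioi x := by simp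
  have hshift : IntegrableOn (fun s => besselP ν (x + s)) (Ioi 0) := by
    rw [← himage] at hint
    exact ((measurePreserving_add_left volume x).integrableOn_image
      (measurableEmbedding_addLeft x)).1 hint
  have hcv : ∫ t in Ioi x, besselP ν t = ∫ s in Ioi 0, besselP ν (x + s) := by
    rw [← himage]
    exact (measurePreserving_add_left volume x).setIntegral_image_emb
      (measurableEmbedding_addLeft x) _ _
  have hle : ∫ t in Ioi x, besselP ν t ≤ besselP ν x / Gamma ν * (√π * Gamma (ν + 1 / 2)) := by
    rw [hcv, ← integral_besselP hν0, ← integral_const_mul]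
    exact setIntegral_mono_on hshift ((integrableOn_besselP hν0).const_mul _) measurableSet_Ioi
      fun s hs => besselP_add_le hν hx hs
  calc ∫ t in Ioi x, t ^ ν * besselK ν t = ∫ t in Ioi x, 2 ^ ν / 2 * besselP ν t :=
        setIntegral_congr_fun measurableSet_Ioi fun t ht => rpow_mul_besselK ν (hx.trans ht)
    _ = 2 ^ ν / 2 * ∫ t in Ioi x, besselP ν t := integral_const_mul _ _
    _ ≤ 2 ^ ν / 2 * (besselP ν x / Gamma ν * (√π * Gamma (ν + 1 / 2))) := by gcongr
    _ = √π * Gamma (ν + 1 / 2) / Gamma ν * (x ^ ν * besselK ν x) := by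
        rw [rpow_mul_besselK ν hx]; ring
    _ = _ := by ring
end

section
/- For every real ν > 0, the function x ↦ 1/x² − x^{ν-2} K_ν(x)/(2^{ν-1} Γ(ν)) is strictly monotone decreasing on (0,∞). -/
open Real MeasureTheory

/-- Secants of `s ↦ 1 - exp (-a s)` from the origin have strictly decreasing slope. -/
theorem one_sub_exp_neg_mul_div_lt {a s t : ℝ} (ha : 0 < a) (hs : 0 < s) (hst : s < t) :
    (1 - Real.exp (-(a * t))) / t < (1 - Real.exp (-(a * s))) / s := by
  have ht : 0 < t := hs.trans hst
  have hne : -(a * t) ≠ 0 := (neg_neg_of_pos (mul_pos ha ht)).ne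
  have h := strictConvexOn_exp.2 (Set.mem_univ (-(a * t))) (Set.mem_univ 0) hne
    (div_pos hs ht) (sub_pos.2 ((div_lt_one ht).2 hst)) (add_sub_cancel _ _)
  have he : (s / t) • (-(a * t)) + (1 - s / t) • (0 : ℝ) = -(a * s) := by
    simp only [smul_eq_mul]
    field_simp
    ring
  rw [he, Real.exp_zero, smul_eq_mul, smul_eq_mul] at h
  rw [lt_div_iff₀ hs]
  have : (1 - Real.exp (-(a * t))) / t * s = s / t - s / t * Real.exp (-(a * t)) := by
    field_simp
  linarith

theorem integrableOn_gamma_mul_exp_neg_div {ν : ℝ} (hν : 0 < ν) (x : ℝ) :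
    IntegrableOn (fun u : ℝ => Real.exp (-u) * u ^ (ν - 1) * Real.exp (-(u⁻¹ / 4 * x ^ 2)))
      (Set.Ioi 0) := by
  refine (Real.GammaIntegral_convergent hν).mul_bdd (c := 1) ?_ ?_
  · exact Measurable.aestronglyMeasurable (by fun_prop)
  · refine (ae_restrict_mem measurableSet_Ioi).mono fun u hu => ?_
    have hu' : 0 < u := hu
    rw [Real.norm_eq_abs, Real.abs_exp, Real.exp_le_one_iff]
    have : 0 ≤ u⁻¹ / 4 * x ^ 2 := by positivity
    linarith

theorem image_const_mul_exp_univ {c : ℝ} (hc : 0 < c) :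
    (fun t : ℝ => c * Real.exp t) '' Set.univ = Set.Ioi 0 := by
  ext u
  simp only [Set.image_univ, Set.mem_range, Set.mem_Ioi]
  constructor
  · rintro ⟨t, rfl⟩
    positivity
  · intro hu
    refine ⟨Real.log (u / c), ?_⟩
    rw [Real.exp_log (div_pos hu hc)]
    field_simp

theorem abs_deriv_smul_gamma_mul_exp_neg_div {x : ℝ} (hx : 0 < x) (ν t : ℝ) :
    |x / 2 * Real.exp t| • (Real.exp (-(x / 2 * Real.exp t)) * (x / 2 * Real.exp t) ^ (ν - 1) *
      Real.exp (-((x / 2 * Real.exp t)⁻¹ / 4 * x ^ 2))) =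
    (x / 2) ^ ν * (Real.exp (-x * Real.cosh t) * Real.exp (ν * t)) := by
  have hu : 0 < x / 2 * Real.exp t := by positivity
  have h1 : (x / 2 * Real.exp t) * (x / 2 * Real.exp t) ^ (ν - 1) =
      (x / 2) ^ ν * Real.exp (ν * t) := by
    rw [Real.rpow_sub_one hu.ne', mul_div_cancel₀ _ hu.ne',
      Real.mul_rpow (by positivity) (Real.exp_pos t).le, ← Real.exp_mul, mul_comm t]
  have h2 : Real.exp (-x * Real.cosh t) = Real.exp (-(x / 2 * Real.exp t)) *
      Real.exp (-((x / 2 * Real.exp t)⁻¹ / 4 * x ^ 2)) := by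
    rw [← Real.exp_add, Real.cosh_eq, mul_inv, ← Real.exp_neg]
    congr 1
    field_simp
    ring
  rw [abs_of_pos hu, smul_eq_mul, h2]
  linear_combination (Real.exp (-(x / 2 * Real.exp t)) *
      Real.exp (-((x / 2 * Real.exp t)⁻¹ / 4 * x ^ 2))) * h1

/-- The Gamma-type representation of `K_ν`, after the substitution `u = x e^t / 2`. -/
theorem rpow_mul_besselK_s16 {ν x : ℝ} (hν : 0 < ν) (hx : 0 < x) :
    x ^ ν * besselK ν x = 2 ^ (ν - 1) * ∫ u in Set.Ioi (0 : ℝ),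
      Real.exp (-u) * u ^ (ν - 1) * Real.exp (-(u⁻¹ / 4 * x ^ 2)) := by
  have hc : 0 < x / 2 := by positivity
  have hcν : 0 < (x / 2) ^ ν := by positivity
  have hd : ∀ t ∈ Set.univ, HasDerivWithinAt (fun t : ℝ => x / 2 * Real.exp t)
      (x / 2 * Real.exp t) Set.univ t := fun t _ =>
    ((Real.hasDerivAt_exp t).const_mul _).hasDerivWithinAt
  have hinj : Set.InjOn (fun t : ℝ => x / 2 * Real.exp t) Set.univ := fun s _ t _ h =>
    Real.exp_injective (mul_left_cancel₀ hc.ne' h)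
  have hint := integrableOn_gamma_mul_exp_neg_div hν x
  rw [← image_const_mul_exp_univ hc,
    integrableOn_image_iff_integrableOn_abs_deriv_smul MeasurableSet.univ hd hinj] at hint
  have hcv := integral_image_eq_integral_abs_deriv_smul MeasurableSet.univ hd hinj
    (fun u : ℝ => Real.exp (-u) * u ^ (ν - 1) * Real.exp (-(u⁻¹ / 4 * x ^ 2)))
  rw [image_const_mul_exp_univ hc] at hcv
  simp only [abs_deriv_smul_gamma_mul_exp_neg_div hx] at hint hcv
  rw [integrableOn_univ] at hint
  rw [setIntegral_univ, integral_const_mul] at hcv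
  have hF : Integrable (fun t : ℝ => Real.exp (-x * Real.cosh t) * Real.exp (ν * t)) := by
    refine (hint.const_mul ((x / 2) ^ ν)⁻¹).congr (Filter.Eventually.of_forall fun t => ?_)
    simp only
    rw [inv_mul_cancel_left₀ hcν.ne']
  have hK : besselK ν x =
      1 / 2 * ∫ t : ℝ, Real.exp (-x * Real.cosh t) * Real.exp (ν * t) := by
    have hneg := integral_comp_neg_Ioi (0 : ℝ)
      (fun t : ℝ => Real.exp (-x * Real.cosh t) * Real.exp (ν * t))
    rw [neg_zero] at hneg
    rw [← intervalIntegral.integral_Iic_add_Ioi hF.integrableOn (hF.integrableOn (s := Set.Ioi 0)),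
      ← hneg, ← integral_add hF.comp_neg.integrableOn hF.integrableOn, ← integral_const_mul]
    unfold besselK
    congr 1 with t
    rw [Real.cosh_neg, Real.cosh_eq (ν * t), mul_neg]
    ring
  rw [hcv, hK]
  generalize (∫ t : ℝ, Real.exp (-x * Real.cosh t) * Real.exp (ν * t)) = M
  rw [Real.div_rpow hx.le two_pos.le, Real.rpow_sub_one two_ne_zero]
  field_simp

theorem setIntegral_Ioi_lt_setIntegral_Ioi {f g : ℝ → ℝ} {a : ℝ}
    (hf : IntegrableOn f (Set.Ioi a)) (hg : IntegrableOn g (Set.Ioi a))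
    (hfg : ∀ u ∈ Set.Ioi a, f u < g u) :
    ∫ u in Set.Ioi a, f u < ∫ u in Set.Ioi a, g u := by
  rw [← sub_pos, ← integral_sub hg hf, setIntegral_pos_iff_support_of_nonneg_ae
    ((ae_restrict_mem measurableSet_Ioi).mono fun u hu => (sub_pos.2 (hfg u hu)).le) (hg.sub hf)]
  have : Set.Ioi a ⊆ Function.support fun u => g u - f u := fun u hu =>
    (sub_pos.2 (hfg u hu)).ne'
  rw [Set.inter_eq_right.2 this, Real.volume_Ioi]
  exact ENNReal.zero_lt_top

theorem integrableOn_gamma_mul_one_sub_exp_div {ν : ℝ} (hν : 0 < ν) (x : ℝ) :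
    IntegrableOn (fun u : ℝ => Real.exp (-u) * u ^ (ν - 1) *
      ((1 - Real.exp (-(u⁻¹ / 4 * x ^ 2))) / x ^ 2)) (Set.Ioi 0) := by
  refine (((Real.GammaIntegral_convergent hν).sub
    (integrableOn_gamma_mul_exp_neg_div hν x)).div_const (x ^ 2)).congr
      (Filter.Eventually.of_forall fun u => ?_)
  simp only [Pi.sub_apply]
  ring

theorem one_div_sq_sub_besselK_eq_integral {ν x : ℝ} (hν : 0 < ν) (hx : 0 < x) :
    1 / x ^ 2 - x ^ (ν - 2) * besselK ν x / (2 ^ (ν - 1) * Real.Gamma ν) =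
      (∫ u in Set.Ioi (0 : ℝ), Real.exp (-u) * u ^ (ν - 1) *
        ((1 - Real.exp (-(u⁻¹ / 4 * x ^ 2))) / x ^ 2)) / Real.Gamma ν := by
  have hΓ : 0 < Real.Gamma ν := Real.Gamma_pos_of_pos hν
  have h2 : (0 : ℝ) < 2 ^ (ν - 1) := by positivity
  have hI : (∫ u in Set.Ioi (0 : ℝ), Real.exp (-u) * u ^ (ν - 1) *
      ((1 - Real.exp (-(u⁻¹ / 4 * x ^ 2))) / x ^ 2)) =
      (Real.Gamma ν - ∫ u in Set.Ioi (0 : ℝ),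
        Real.exp (-u) * u ^ (ν - 1) * Real.exp (-(u⁻¹ / 4 * x ^ 2))) / x ^ 2 := by
    rw [Real.Gamma_eq_integral hν, ← integral_sub (Real.GammaIntegral_convergent hν)
      (integrableOn_gamma_mul_exp_neg_div hν x), ← integral_div]
    congr 1 with u
    ring
  have hp : x ^ (ν - 2) = x ^ ν / x ^ 2 := by
    rw [Real.rpow_sub hx, Real.rpow_two]
  rw [hI, hp, div_mul_eq_mul_div, rpow_mul_besselK_s16 hν hx]
  generalize (∫ u in Set.Ioi (0 : ℝ),
    Real.exp (-u) * u ^ (ν - 1) * Real.exp (-(u⁻¹ / 4 * x ^ 2))) = M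
  field_simp

theorem besselK_strictAntiOn (ν : ℝ) (hν : 0 < ν) :
    StrictAntiOn (fun x : ℝ => 1 / x ^ 2 - x ^ (ν - 2) * besselK ν x / (2 ^ (ν - 1) * Real.Gamma ν))
      (Set.Ioi 0) := by
  intro x hx y hy hxy
  have hx' : 0 < x := hx
  simp only [one_div_sq_sub_besselK_eq_integral hν hx, one_div_sq_sub_besselK_eq_integral hν hy]
  refine div_lt_div_of_pos_right ?_ (Real.Gamma_pos_of_pos hν)
  refine setIntegral_Ioi_lt_setIntegral_Ioi (integrableOn_gamma_mul_one_sub_exp_div hν y)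
    (integrableOn_gamma_mul_one_sub_exp_div hν x) fun u hu => ?_
  have hu' : 0 < u := hu
  have hsq : x ^ 2 < y ^ 2 := by gcongr
  exact mul_lt_mul_of_pos_left
    (one_sub_exp_neg_mul_div_lt (by positivity) (by positivity) hsq) (by positivity)
end

section
/- For all x > 0: if ν > 0 then 0 < 1/x² − x^{ν-2} K_ν(x)/(2^{ν-1} Γ(ν)), and if ν > 1 then additionally 1/x² − x^{ν-2} K_ν(x)/(2^{ν-1} Γ(ν)) ≤ 1/(4(ν-1)). -/
open Real MeasureTheory

/-- The heat-kernel type representation integrand of `besselK`. -/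
noncomputable def besselKIntegrand (ν x s : ℝ) : ℝ :=
  Real.exp (-s) * Real.exp (-(x ^ 2 / (4 * s))) * s ^ (ν - 1)

theorem besselKIntegrand_eq (ν x s : ℝ) : besselKIntegrand ν x s =
    Real.exp (-(x ^ 2 / (4 * s))) * (Real.exp (-s) * s ^ (ν - 1)) := by
  unfold besselKIntegrand; ring

theorem integrableOn_besselKIntegrand {ν : ℝ} (hν : 0 < ν) (x : ℝ) :
    IntegrableOn (besselKIntegrand ν x) (Set.Ioi 0) := by
  refine Integrable.mono' (Real.GammaIntegral_convergent hν) ?_ ?_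
  · unfold besselKIntegrand
    exact Measurable.aestronglyMeasurable (by fun_prop)
  · filter_upwards [ae_restrict_mem measurableSet_Ioi] with s hs
    have hs : 0 < s := hs
    rw [besselKIntegrand_eq, Real.norm_of_nonneg (by positivity)]
    exact mul_le_of_le_one_left (by positivity) (Real.exp_le_one_iff.2 (by
      have : 0 ≤ x ^ 2 / (4 * s) := by positivity
      linarith))

theorem besselKIntegrand_comp_exp (ν : ℝ) {x : ℝ} (hx : 0 < x) (t : ℝ) :
    |x / 2 * Real.exp t| • besselKIntegrand ν x (x / 2 * Real.exp t) =
      (x / 2) ^ ν * (Real.exp (-x * Real.cosh t) * Real.exp (ν * t)) := by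
  have hp : 0 < x / 2 * Real.exp t := by positivity
  have h1 : (x / 2 * Real.exp t) * (x / 2 * Real.exp t) ^ (ν - 1) =
      (x / 2) ^ ν * Real.exp (ν * t) := by
    rw [Real.rpow_sub_one hp.ne', mul_div_cancel₀ _ hp.ne',
      Real.mul_rpow (by positivity) (by positivity), ← Real.exp_mul, mul_comm t]
  have h2 : Real.exp (-(x / 2 * Real.exp t)) *
      Real.exp (-(x ^ 2 / (4 * (x / 2 * Real.exp t)))) = Real.exp (-x * Real.cosh t) := by
    rw [← Real.exp_add, Real.cosh_eq, Real.exp_neg t]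
    congr 1
    field_simp
    ring
  rw [abs_of_pos hp, smul_eq_mul, besselKIntegrand, h2, mul_left_comm, h1]
  ring

theorem integral_besselKIntegrand {ν x : ℝ} (hν : 0 < ν) (hx : 0 < x) :
    ∫ s in Set.Ioi 0, besselKIntegrand ν x s = 2 * (x / 2) ^ ν * besselK ν x := by
  have hd : ∀ t ∈ (Set.univ : Set ℝ), HasDerivWithinAt (fun t => x / 2 * Real.exp t)
      (x / 2 * Real.exp t) Set.univ t := fun t _ =>
    ((Real.hasDerivAt_exp t).const_mul _).hasDerivWithinAt
  have hinj : Set.InjOn (fun t => x / 2 * Real.exp t) Set.univ := fun a _ b _ h =>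
    Real.exp_injective (mul_left_cancel₀ (by positivity) h)
  have himg : (fun t => x / 2 * Real.exp t) '' Set.univ = Set.Ioi 0 := by
    ext s
    simp only [Set.image_univ, Set.mem_range, Set.mem_Ioi]
    constructor
    · rintro ⟨t, rfl⟩
      positivity
    · intro hs
      refine ⟨Real.log (s / (x / 2)), ?_⟩
      rw [Real.exp_log (by positivity)]
      field_simp
  have hc : (x / 2) ^ ν ≠ 0 := by positivity
  have hint : Integrable fun t => Real.exp (-x * Real.cosh t) * Real.exp (ν * t) := by
    have h := (integrableOn_image_iff_integrableOn_abs_deriv_smul MeasurableSet.univ hd hinj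
      (besselKIntegrand ν x)).1 (himg ▸ integrableOn_besselKIntegrand hν x)
    simp only [besselKIntegrand_comp_exp ν hx, integrableOn_univ] at h
    exact (integrable_const_mul_iff hc.isUnit _).1 h
  have h := integral_image_eq_integral_abs_deriv_smul MeasurableSet.univ hd hinj
    (besselKIntegrand ν x)
  simp only [besselKIntegrand_comp_exp ν hx, himg, setIntegral_univ] at h
  rw [h, integral_const_mul, ← intervalIntegral.integral_Iic_add_Ioi (b := 0)
    hint.integrableOn hint.integrableOn]
  have hneg := integral_comp_neg_Ioi 0
    (fun t => Real.exp (-x * Real.cosh t) * Real.exp (ν * t))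
  rw [neg_zero] at hneg
  rw [← hneg, ← integral_add hint.comp_neg.integrableOn hint.integrableOn, mul_comm 2, mul_assoc,
    besselK, ← integral_const_mul 2]
  congr 2
  ext t
  rw [Real.cosh_neg, Real.cosh_eq (ν * t), mul_neg]
  ring

theorem integral_besselKIntegrand_lt_Gamma {ν x : ℝ} (hν : 0 < ν) (hx : 0 < x) :
    ∫ s in Set.Ioi 0, besselKIntegrand ν x s < Real.Gamma ν := by
  have hG := Real.GammaIntegral_convergent hν
  have hB := integrableOn_besselKIntegrand hν x
  have hpos : ∀ s ∈ Set.Ioi (0 : ℝ),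
      0 < Real.exp (-s) * s ^ (ν - 1) - besselKIntegrand ν x s := by
    intro s hs
    have hs : 0 < s := hs
    rw [besselKIntegrand_eq, sub_pos]
    exact mul_lt_of_lt_one_left (by positivity) (Real.exp_lt_one_iff.2 (neg_lt_zero.2 (by positivity)))
  have hsub : IntegrableOn
      (fun s => Real.exp (-s) * s ^ (ν - 1) - besselKIntegrand ν x s) (Set.Ioi 0) := hG.sub hB
  rw [Real.Gamma_eq_integral hν, ← sub_pos, ← integral_sub hG hB,
    setIntegral_pos_iff_support_of_nonneg_ae _ hsub]
  · have : Set.Ioi (0 : ℝ) ⊆ Function.support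
        (fun s => Real.exp (-s) * s ^ (ν - 1) - besselKIntegrand ν x s) :=
      fun s hs => (hpos s hs).ne'
    rw [Set.inter_eq_right.2 this]
    simp
  · filter_upwards [ae_restrict_mem measurableSet_Ioi] with s hs
    exact (hpos s hs).le

theorem Gamma_sub_le_integral_besselKIntegrand {ν : ℝ} (hν : 1 < ν) (x : ℝ) :
    Real.Gamma ν - x ^ 2 / 4 * Real.Gamma (ν - 1) ≤
      ∫ s in Set.Ioi 0, besselKIntegrand ν x s := by
  have hν0 : 0 < ν := by linarith
  have hν1 : 0 < ν - 1 := by linarith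
  have hG := Real.GammaIntegral_convergent hν0
  have hG' := (Real.GammaIntegral_convergent hν1).const_mul (x ^ 2 / 4)
  rw [Real.Gamma_eq_integral hν0, Real.Gamma_eq_integral hν1, ← integral_const_mul,
    ← integral_sub hG hG']
  refine setIntegral_mono_on (hG.sub hG') (integrableOn_besselKIntegrand hν0 x)
    measurableSet_Ioi fun s hs => ?_
  have hs : 0 < s := hs
  have h : Real.exp (-s) * s ^ (ν - 1) - x ^ 2 / 4 * (Real.exp (-s) * s ^ (ν - 1 - 1)) =
      (-(x ^ 2 / (4 * s)) + 1) * (Real.exp (-s) * s ^ (ν - 1)) := by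
    rw [Real.rpow_sub_one hs.ne' (ν - 1)]
    field_simp
    ring
  rw [h, besselKIntegrand_eq]
  exact mul_le_mul_of_nonneg_right (Real.add_one_le_exp _) (by positivity)

theorem one_div_sq_sub_besselK {ν x : ℝ} (hν : 0 < ν) (hx : 0 < x) :
    1 / x ^ 2 - x ^ (ν - 2) * besselK ν x / (2 ^ (ν - 1) * Real.Gamma ν) =
      (Real.Gamma ν - ∫ s in Set.Ioi 0, besselKIntegrand ν x s) / (x ^ 2 * Real.Gamma ν) := by
  have hΓ := (Real.Gamma_pos_of_pos hν).ne'
  have h2 : (2 : ℝ) ^ ν ≠ 0 := by positivity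
  have hxν : x ^ (ν - 2) = x ^ ν / x ^ 2 := by
    rw [Real.rpow_sub hx, Real.rpow_two]
  rw [integral_besselKIntegrand hν hx, hxν, Real.rpow_sub_one two_ne_zero,
    Real.div_rpow hx.le two_pos.le]
  field_simp

theorem besselK_bounds (ν x : ℝ) (hx : 0 < x) :
    (0 < ν → 0 < 1 / x ^ 2 - x ^ (ν - 2) * besselK ν x / (2 ^ (ν - 1) * Real.Gamma ν)) ∧
    (1 < ν → 1 / x ^ 2 - x ^ (ν - 2) * besselK ν x / (2 ^ (ν - 1) * Real.Gamma ν) ≤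
      1 / (4 * (ν - 1))) := by
  refine ⟨fun hν => ?_, fun hν => ?_⟩
  · have hΓ := Real.Gamma_pos_of_pos hν
    rw [one_div_sq_sub_besselK hν hx]
    exact div_pos (sub_pos.2 (integral_besselKIntegrand_lt_Gamma hν hx)) (by positivity)
  · have hν1 : 0 < ν - 1 := by linarith
    have hΓ := Real.Gamma_pos_of_pos hν1
    have hrec : Real.Gamma ν = (ν - 1) * Real.Gamma (ν - 1) := by
      simpa using Real.Gamma_add_one hν1.ne'
    have hle := Gamma_sub_le_integral_besselKIntegrand hν x
    rw [one_div_sq_sub_besselK (by linarith) hx]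
    calc _ ≤ x ^ 2 / 4 * Real.Gamma (ν - 1) / (x ^ 2 * Real.Gamma ν) := by
          have : 0 < Real.Gamma ν := Real.Gamma_pos_of_pos (by linarith)
          gcongr
          linarith
      _ = 1 / (4 * (ν - 1)) := by
          rw [hrec]
          field_simp
end

section
/- For all x > 0, Γ(x+1/2)/Γ(x+1) < √(2/π) e^x K_0(x). -/
open Real MeasureTheory

/-- The modified Bessel function of the second kind of order zero,
`K_0(x) = ∫_1^∞ e^{-xt}/√(t²-1) dt`. -/
noncomputable def besselK0 (x : ℝ) : ℝ :=
  ∫ t in Set.Ioi (1 : ℝ), Real.exp (-x * t) / Real.sqrt (t ^ 2 - 1)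

/-- Strict monotonicity of the set integral for functions ordered strictly at every point of a
set of positive measure. -/
theorem setIntegral_lt_setIntegral_of_forall_lt {α : Type*} [MeasurableSpace α] {μ : Measure α}
    {s : Set α} (hs : MeasurableSet s) (hμs : μ s ≠ 0) {f g : α → ℝ}
    (hf : IntegrableOn f s μ) (hg : IntegrableOn g s μ) (hlt : ∀ a ∈ s, f a < g a) :
    ∫ a in s, f a ∂μ < ∫ a in s, g a ∂μ := by
  rw [← sub_pos, ← integral_sub hg hf, setIntegral_pos_iff_support_of_nonneg_ae]
  · refine (pos_iff_ne_zero.2 hμs).trans_le (measure_mono fun a ha => ⟨?_, ha⟩)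
    exact (sub_pos.2 (hlt a ha)).ne'
  · filter_upwards [ae_restrict_mem hs] with a ha
    exact (sub_pos.2 (hlt a ha)).le
  · exact hg.sub hf

/-- Euler's beta integral over the reals. -/
theorem integral_Ioo_rpow_mul_one_sub_rpow {a b : ℝ} (ha : 0 < a) (hb : 0 < b) :
    ∫ u in Set.Ioo (0 : ℝ) 1, u ^ (a - 1) * (1 - u) ^ (b - 1) =
      Real.Gamma a * Real.Gamma b / Real.Gamma (a + b) := by
  have h := ProbabilityTheory.beta_eq_betaIntegralReal a b ha hb
  rw [ProbabilityTheory.beta] at h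
  rw [h, Complex.betaIntegral, intervalIntegral.integral_of_le zero_le_one,
    integral_Ioc_eq_integral_Ioo]
  rw [← Complex.ofReal_re (∫ u in Set.Ioo (0 : ℝ) 1, u ^ (a - 1) * (1 - u) ^ (b - 1)),
    ← integral_complex_ofReal]
  congr 1
  refine setIntegral_congr_fun measurableSet_Ioo fun u hu => ?_
  have h1 : 0 ≤ 1 - u := (sub_pos.2 hu.2).le
  push_cast [Complex.ofReal_cpow hu.1.le, Complex.ofReal_cpow h1]
  rfl

/-- The beta integral `B(x + 1/2, 1/2)` after the substitution `u = exp (1 - t)`. -/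
theorem integral_Ioi_exp_div_sqrt_exp_sub_one {x : ℝ} (hx : -(1 / 2) < x) :
    ∫ t in Set.Ioi (1 : ℝ), exp (-x * (t - 1)) / √(exp (t - 1) - 1) =
      √π * (Real.Gamma (x + 1 / 2) / Real.Gamma (x + 1)) := by
  have hbeta := integral_Ioo_rpow_mul_one_sub_rpow (a := x + 1 / 2) (b := 1 / 2)
    (by linarith) (by norm_num)
  have himage : (fun t : ℝ => exp (1 - t)) '' Set.Ioi 1 = Set.Ioo 0 1 := by
    ext u
    constructor
    · rintro ⟨t, ht, rfl⟩
      exact ⟨exp_pos _, exp_lt_one_iff.2 (sub_neg.2 ht)⟩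
    · rintro ⟨h0, h1⟩
      refine ⟨1 - log u, ?_, by simp [exp_log h0]⟩
      have := log_neg h0 h1
      simp only [Set.mem_Ioi]
      linarith
  have hderiv : ∀ t ∈ Set.Ioi (1 : ℝ),
      HasDerivWithinAt (fun t : ℝ => exp (1 - t)) (-exp (1 - t)) (Set.Ioi 1) t := by
    intro t _
    simpa using (((hasDerivAt_id t).const_sub 1).exp).hasDerivWithinAt
  have hinj : Set.InjOn (fun t : ℝ => exp (1 - t)) (Set.Ioi 1) := by
    intro s _ t _ h
    have := exp_injective h
    linarith
  rw [← himage, integral_image_eq_integral_abs_deriv_smul measurableSet_Ioi hderiv hinj,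
    Real.Gamma_one_half_eq, show x + 1 / 2 + 1 / 2 = x + 1 by ring] at hbeta
  rw [← mul_div_assoc, mul_comm (√π), ← hbeta]
  refine setIntegral_congr_fun measurableSet_Ioi fun t ht => ?_
  have hpos : 0 < exp (t - 1) - 1 := sub_pos.2 (one_lt_exp_iff.2 (sub_pos.2 ht))
  have hfactor : 1 - exp (1 - t) = exp (1 - t) * (exp (t - 1) - 1) := by
    rw [mul_sub, ← exp_add]
    simp
  simp only [smul_eq_mul, abs_neg, abs_exp]
  rw [hfactor, mul_rpow (exp_pos _).le hpos.le, ← exp_mul, ← exp_mul,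
    show (1 / 2 - 1 : ℝ) = -(1 / 2) by norm_num, rpow_neg hpos.le, ← sqrt_eq_rpow,
    div_eq_mul_inv, ← mul_assoc, ← mul_assoc, ← exp_add, ← exp_add]
  congr 2
  ring

theorem integrableOn_exp_div_sqrt_sq_sub_one {x : ℝ} (hx : 0 < x) :
    IntegrableOn (fun t => exp (-x * t) / √(t ^ 2 - 1)) (Set.Ioi 1) := by
  have hdom : IntegrableOn (fun t : ℝ => (t - 1) ^ (-(1 / 2) : ℝ) * exp (-x * (t - 1) ^ (1 : ℝ)))
      (Set.Ioi 1) := by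
    have h := integrableOn_rpow_mul_exp_neg_mul_rpow (p := 1) (s := -(1 / 2)) (b := x)
      (by norm_num) one_pos hx
    have hmp := (measurePreserving_sub_right volume (1 : ℝ)).integrableOn_comp_preimage
      (measurableEmbedding_subRight (1 : ℝ)) (s := Set.Ioi 0)
      (f := fun s : ℝ => s ^ (-(1 / 2) : ℝ) * exp (-x * s ^ (1 : ℝ)))
    have h' := hmp.2 h
    simpa [Function.comp_def] using h'
  refine hdom.mono' (by fun_prop : Measurable _).aestronglyMeasurable ?_
  filter_upwards [ae_restrict_mem measurableSet_Ioi] with t ht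
  have ht : 1 < t := ht
  have h1 : 0 < t - 1 := sub_pos.2 ht
  rw [norm_of_nonneg (by positivity), rpow_one, rpow_neg h1.le, ← sqrt_eq_rpow, inv_mul_eq_div]
  have hs : 0 < √(t - 1) := sqrt_pos.2 h1
  refine div_le_div₀ (exp_pos _).le (exp_le_exp.2 ?_) hs (sqrt_le_sqrt ?_) <;> nlinarith

theorem exp_div_sqrt_exp_sub_one_lt (x : ℝ) {t : ℝ} (ht : 1 < t) :
    exp (-x * (t - 1)) / √(exp (t - 1) - 1) <
      √2 * exp x * (exp (-x * t) / √(t ^ 2 - 1)) := by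
  have h1 : 0 < t - 1 := sub_pos.2 ht
  have hexp : (t ^ 2 - 1) / 2 < exp (t - 1) - 1 := by
    have h := sum_le_exp_of_nonneg h1.le 4
    norm_num [Finset.sum_range_succ, Nat.factorial] at h
    nlinarith [pow_pos h1 3]
  have hsq : 0 < t ^ 2 - 1 := by nlinarith
  have hrhs : √2 * exp x * (exp (-x * t) / √(t ^ 2 - 1)) =
      exp (-x * (t - 1)) / √((t ^ 2 - 1) / 2) := by
    rw [sqrt_div hsq.le, show -x * (t - 1) = x + -x * t by ring, exp_add]
    field_simp
  rw [hrhs]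
  gcongr

theorem gamma_ratio_lt_besselK0 (x : ℝ) (hx : 0 < x) :
    Real.Gamma (x + 1 / 2) / Real.Gamma (x + 1) <
      Real.sqrt (2 / π) * Real.exp x * besselK0 x := by
  have hint := (integrableOn_exp_div_sqrt_sq_sub_one hx).const_mul (√2 * exp x)
  have hint' : IntegrableOn (fun t => exp (-x * (t - 1)) / √(exp (t - 1) - 1)) (Set.Ioi 1) := by
    refine hint.mono' (by fun_prop : Measurable _).aestronglyMeasurable ?_
    filter_upwards [ae_restrict_mem measurableSet_Ioi] with t ht
    rw [norm_of_nonneg (by positivity)]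
    exact (exp_div_sqrt_exp_sub_one_lt x ht).le
  have hlt := setIntegral_lt_setIntegral_of_forall_lt measurableSet_Ioi (by simp) hint' hint
    fun t ht => exp_div_sqrt_exp_sub_one_lt x ht
  rw [integral_Ioi_exp_div_sqrt_exp_sub_one (by linarith), integral_const_mul] at hlt
  have hpi : 0 < √π := sqrt_pos.2 pi_pos
  rw [besselK0, sqrt_div zero_le_two, div_mul_eq_mul_div, div_mul_eq_mul_div, lt_div_iff₀' hpi]
  exact hlt
end
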